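/- Let K be a henselian valued field of equicharacteristic 0 (i.e. K and its residue field both have characteristic 0 and the valuation ring O_K is a henselian local ring), with a fixed pseudo-uniformizer t and a fixed lift k̃ of the residue field. Fix integers d ≥ 1 and n > m ≥ 1, set μ = D_n(d), let r be the integer with D_m(r−1) ≤ μ < D_m(r), V = Σ_{k=0}^{d} k·L_n(k), and e = Σ_{k=1}^{r−1} k·L_m(k) + r·(μ − D_m(r−1)). Let s and α be positive integers with α > sV/e, let U ⊆ O_K^m, and suppose ψ = (ψ_1, …, ψ_n) : U → O_K^n satisfies T_r-approximation. Let B ⊆ O_K^m be a product of m closed balls of radius |t|^α, and let x_1, …, x_μ ∈ B ∩ U be points with ψ(x_i) ∈ (k̃[t]_s)^n for all i. Then det((ψ(x_i)^j)_{1≤i≤μ, j∈Δ_n(d)}) = 0, where for j = (j_1,…,j_n) ∈ Δ_n(d) the symbol ψ(x_i)^j denotes Π_{l=1}^{n} ψ_l(x_i)^{j_l}. -/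

import Mathlib

/-- The set `Δ_m(k)` of multi-indices in `ℕ^m` of total degree at most `k`
(coded with coordinates in `Fin (k+1)` to make it a finite type). -/
abbrev DeltaIdx (m k : ℕ) : Type :=
  {α : Fin m → Fin (k + 1) // ∑ i, (α i : ℕ) ≤ k}

/-- `L_m(k)`, the number of multi-indices in `ℕ^m` of total degree exactly `k`,
i.e. the number of monomials of degree exactly `k` in `m` variables. -/
def Lnum (m k : ℕ) : ℕ :=
  Fintype.card {α : Fin m → Fin (k + 1) // ∑ i, (α i : ℕ) = k}

/-- `D_m(k)`, the number of multi-indices in `ℕ^m` of total degree at most `k`,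
i.e. the number of monomials of degree at most `k` in `m` variables. -/
def Dnum (m k : ℕ) : ℕ := Fintype.card (DeltaIdx m k)

/-- `kt` is a lift of the residue field: it is contained in the valuation ring and the
residue map restricts to a bijection from `kt` to the residue field. -/
def IsLift {K Γ : Type*} [Field K] [LinearOrderedCommGroupWithZero Γ]
    (v : Valuation K Γ) (kt : Subfield K) : Prop :=
  (∀ x ∈ kt, v x ≤ 1) ∧ ∀ x : K, v x ≤ 1 → ∃! a : K, a ∈ kt ∧ v (x - a) < 1

/-- The set `k̃[t]_s` of polynomials in `t` of degree `< s` with coefficients in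
the lift `kt` of the residue field. -/
def ktPoly {K : Type*} [Field K] (kt : Subfield K) (t : K) (s : ℕ) : Set K :=
  {x | ∃ a : Fin s → K, (∀ i, a i ∈ kt) ∧ x = ∑ i, a i * t ^ (i : ℕ)}

/-- In a linearly ordered commutative group with zero, `0` is a bottom element. -/
noncomputable instance instOrderBotOfLinearOrderedCommGroupWithZero
    {Γ : Type*} [LinearOrderedCommGroupWithZero Γ] : OrderBot Γ where
  bot := 0
  bot_le _ := zero_le'

/-- `ψ : U ⊆ K^m → K` satisfies `T_r`-approximation: for each `y ∈ U` there is a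
polynomial `T_y` of total degree `< r` with coefficients in the valuation ring such that
`|ψ(x) − T_y(x)| ≤ |x − y|^r` for all `x ∈ U`, with the maximum norm on `K^m`. -/
def TrApprox {K Γ : Type*} [Field K] [LinearOrderedCommGroupWithZero Γ]
    (v : Valuation K Γ) {m : ℕ} (U : Set (Fin m → K))
    (ψ : (Fin m → K) → K) (r : ℕ) : Prop :=
  ∀ y ∈ U, ∃ T : MvPolynomial (Fin m) K,
    T.totalDegree < r ∧ (∀ c, v (T.coeff c) ≤ 1) ∧
    ∀ x ∈ U, v (ψ x - MvPolynomial.eval x T) ≤ (Finset.univ.sup fun i => v (x i - y i)) ^ r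

/-- `r(m, μ)`: the unique integer `r` with `D_m(r−1) ≤ μ < D_m(r)`, defined as the least
`r` with `μ < D_m(r)`. -/
noncomputable def rfun (m μ : ℕ) : ℕ := sInf {x : ℕ | μ < Dnum m x}

/-- `V(n,d) = Σ_{k=0}^{d} k·L_n(k)`. -/
def Vfun (n d : ℕ) : ℕ := ∑ k ∈ Finset.range (d + 1), k * Lnum n k

/-- `e(n,m,d) = Σ_{k=1}^{r−1} k·L_m(k) + r·(μ − D_m(r−1))` where `μ = D_n(d)` and
`r = r(m,d)`. -/
noncomputable def efun (n m d : ℕ) : ℕ :=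
  (∑ k ∈ Finset.Icc 1 (rfun m (Dnum n d) - 1), k * Lnum m k) +
    rfun m (Dnum n d) * (Dnum n d - Dnum m (rfun m (Dnum n d) - 1))

section Valuation

variable {K Γ : Type*} [Field K] [LinearOrderedCommGroupWithZero Γ] (v : Valuation K Γ)

theorem Valuation.algebraMap_integer_apply (a : v.integer) :
    algebraMap v.integer K a = a := rfl

theorem Valuation.map_prod_pow_sub_prod_pow_le {ι : Type*} (S : Finset ι) {a b : ι → K}
    {γ : Γ} (ha : ∀ q, v (a q) ≤ 1) (hb : ∀ q, v (b q) ≤ 1) (hab : ∀ q, v (a q - b q) ≤ γ)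
    (k : ι → ℕ) : v (∏ q ∈ S, a q ^ k q - ∏ q ∈ S, b q ^ k q) ≤ γ := by
  have hmul : ∀ {x y z w : K}, v y ≤ 1 → v z ≤ 1 → v (x - z) ≤ γ → v (y - w) ≤ γ →
      v (x * y - z * w) ≤ γ := by
    intro x y z w hy hz hxz hyw
    rw [show x * y - z * w = (x - z) * y + z * (y - w) by ring]
    refine v.map_add_le ?_ ?_
    · rw [map_mul]; exact (mul_le_mul' hxz hy).trans_eq (mul_one _)
    · rw [map_mul]; exact (mul_le_mul' hz hyw).trans_eq (one_mul _)
  have hpow : ∀ q n, v (a q ^ n - b q ^ n) ≤ γ := by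
    intro q n
    induction n with
    | zero => simp
    | succ n ih =>
      rw [pow_succ, pow_succ]
      exact hmul (ha q) (by rw [map_pow]; exact pow_le_one' (hb q) n) ih (hab q)
  classical
  induction S using Finset.induction_on with
  | empty => simp
  | insert q S hq ih =>
    rw [Finset.prod_insert hq, Finset.prod_insert hq]
    refine hmul ?_ (by rw [map_pow]; exact pow_le_one' (hb q) _) (hpow _ _) ih
    rw [map_prod]
    exact Finset.prod_le_one' fun i _ => by rw [map_pow]; exact pow_le_one' (ha i) _

theorem Valuation.map_det_le {ι : Type*} [Fintype ι] [DecidableEq ι] (M : Matrix ι ι K)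
    (g : ι → Γ) (hM : ∀ i l, v (M i l) ≤ g i) : v M.det ≤ ∏ i, g i := by
  rw [← Matrix.det_transpose, Matrix.det_apply]
  refine v.map_sum_le fun σ _ => ?_
  have : v (Equiv.Perm.sign σ • ∏ i, M.transpose (σ i) i) = v (∏ i, M i (σ i)) := by
    rcases Int.units_eq_one_or (Equiv.Perm.sign σ) with h | h <;> simp [h, Valuation.map_neg]
  rw [this, map_prod]
  exact Finset.prod_le_prod' fun i _ => hM i _

theorem Valuation.map_det_mul_le {ι κ : Type*} [Fintype ι] [DecidableEq ι] [Fintype κ]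
    (N : Matrix ι κ K) (P : Matrix κ ι K) {ρ : Γ} (hρ : ρ ≤ 1) (w : κ → ℕ)
    (hN : ∀ i a, v (N i a) ≤ ρ ^ w a) (hP : ∀ a l, v (P a l) ≤ 1) (e : ℕ)
    (he : ∀ f : ι → κ, Function.Injective f → e ≤ ∑ l, w (f l)) :
    v (N * P).det ≤ ρ ^ e := by
  classical
  have hrow : (N * P).transpose = fun l => ∑ a, P a l • N.transpose a := by
    ext l i
    simp [Matrix.mul_apply, Finset.sum_apply, mul_comm]
  have hdet : (N * P).det = ∑ f : ι → κ,
      (∏ l, P (f l) l) * Matrix.detRowAlternating (fun l => N.transpose (f l)) := by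
    rw [← Matrix.det_transpose, hrow]
    change Matrix.detRowAlternating.toMultilinearMap _ = _
    rw [MultilinearMap.map_sum]
    refine Finset.sum_congr rfl fun f _ => ?_
    rw [MultilinearMap.map_smul_univ]
    rfl
  rw [hdet]
  refine v.map_sum_le fun f _ => ?_
  by_cases hf : Function.Injective f
  · rw [map_mul, map_prod]
    have h1 : v (Matrix.detRowAlternating (fun l => N.transpose (f l))) ≤ ρ ^ e := by
      refine (v.map_det_le (fun l => N.transpose (f l)) (fun l => ρ ^ w (f l))
        fun l i => hN i (f l)).trans ?_
      rw [Finset.prod_pow_eq_pow_sum]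
      exact pow_le_pow_right_of_le_one' hρ (he f hf)
    exact (mul_le_mul' (Finset.prod_le_one' fun l _ => hP (f l) l) h1).trans_eq (one_mul _)
  · rw [AlternatingMap.map_eq_zero_of_not_injective]
    · simp
    · exact fun h => hf fun a b hab => h (by simp [hab])

theorem Valuation.pow_le_map_eval_of_mem_subfield {kt : Subfield K} (hkt : ∀ x ∈ kt, v x ≤ 1)
    {t : K} (ht1 : v t < 1) (N : ℕ) (Q : Polynomial kt) (hQ : Q ≠ 0) (hN : Q.natDegree ≤ N) :
    v t ^ N ≤ v (Polynomial.aeval t Q) := by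
  have hunit : ∀ a : kt, a ≠ 0 → v (a : K) = 1 := by
    intro a ha
    have ha0 : (a : K) ≠ 0 := by simpa using ha
    refine le_antisymm (hkt a a.2) ?_
    have := hkt _ (kt.inv_mem a.2)
    rw [map_inv₀] at this
    exact (inv_le_one₀ (zero_lt_iff.2 (v.ne_zero_iff.2 ha0))).1 this
  have hint : ∀ P : Polynomial kt, v (Polynomial.aeval t P) ≤ 1 := by
    intro P
    rw [Polynomial.aeval_eq_sum_range]
    refine v.map_sum_le fun i _ => ?_
    rw [Algebra.smul_def, map_mul, map_pow]
    exact mul_le_one' (hkt _ (P.coeff i).2) (pow_le_one' ht1.le i)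
  induction N generalizing Q with
  | zero =>
    rw [Polynomial.eq_C_of_natDegree_le_zero hN] at hQ ⊢
    rw [Polynomial.aeval_C, pow_zero]
    exact (hunit _ fun h => hQ (by rw [h, map_zero])).ge
  | succ N ih =>
    have hsplit := Q.divX_mul_X_add
    have heval : Polynomial.aeval t Q = Polynomial.aeval t Q.divX * t + (Q.coeff 0 : K) := by
      conv_lhs => rw [← hsplit]
      simp only [map_add, map_mul, Polynomial.aeval_X, Polynomial.aeval_C]
      rfl
    by_cases h0 : Q.coeff 0 = 0
    · rw [heval, h0]
      have hd : Q.divX ≠ 0 := by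
        intro h
        rw [h, h0] at hsplit
        exact hQ (by simpa using hsplit.symm)
      have := ih Q.divX hd (by rw [Polynomial.natDegree_divX_eq_natDegree_tsub_one]; omega)
      simp only [ZeroMemClass.coe_zero, add_zero, map_mul, pow_succ]
      exact mul_le_mul_left this _
    · have hlt : v (Polynomial.aeval t Q.divX * t) < v (Q.coeff 0 : K) := by
        rw [hunit _ h0, map_mul]
        exact (mul_le_mul_left (hint _) _).trans_lt (by rwa [one_mul])
      rw [heval, v.map_add_eq_of_lt_right hlt, hunit _ h0]
      exact pow_le_one' ht1.le _

theorem exists_truncated_expansion {m : ℕ} (P : MvPolynomial (Fin m) v.integer) {ρ : Γ}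
    (hρ : ρ ≤ 1) (R : ℕ) :
    ∃ c : DeltaIdx m R → K, (∀ a, v (c a) ≤ 1) ∧ ∀ z : Fin m → K, (∀ i, v (z i) ≤ ρ) →
      v (MvPolynomial.aeval z P - ∑ a, (∏ i, z i ^ (a.1 i : ℕ)) * c a) ≤ ρ ^ (R + 1) := by
  classical
  induction P using MvPolynomial.induction_on' with
  | monomial u a =>
    by_cases hu : ∑ i, u i ≤ R
    · have hlt : ∀ i, u i < R + 1 := fun i => Nat.lt_succ_of_le
        ((Finset.single_le_sum (f := fun i => u i) (fun _ _ => Nat.zero_le _)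
          (Finset.mem_univ i)).trans hu)
      refine ⟨Pi.single ⟨fun i => ⟨u i, hlt i⟩, hu⟩ (a : K), fun b => ?_, fun z _ => ?_⟩
      · rw [Pi.single_apply]
        split_ifs
        · exact a.2
        · simp
      · simp only [MvPolynomial.aeval_monomial, Pi.single_apply, mul_ite, mul_zero,
          Finset.sum_ite_eq', Finset.mem_univ, if_true]
        rw [Finsupp.prod_fintype _ _ (fun _ => pow_zero _), mul_comm]
        simp [v.algebraMap_integer_apply]
    · refine ⟨0, by simp, fun z hz => ?_⟩
      simp only [MvPolynomial.aeval_monomial, Pi.zero_apply, mul_zero, Finset.sum_const_zero,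
        sub_zero]
      rw [Finsupp.prod_fintype _ _ (fun _ => pow_zero _), map_mul, map_prod]
      have h1 : ∏ i, v (z i ^ u i) ≤ ρ ^ (R + 1) := by
        calc ∏ i, v (z i ^ u i) ≤ ∏ i, ρ ^ u i :=
              Finset.prod_le_prod' fun i _ => by rw [map_pow]; exact pow_le_pow_left' (hz i) _
          _ = ρ ^ ∑ i, u i := Finset.prod_pow_eq_pow_sum _ _ _
          _ ≤ ρ ^ (R + 1) := pow_le_pow_right_of_le_one' hρ (by omega)
      exact (mul_le_mul' a.2 h1).trans_eq (one_mul _)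
  | add p q hp hq =>
    obtain ⟨c, hc, hcz⟩ := hp
    obtain ⟨c', hc', hcz'⟩ := hq
    refine ⟨c + c', fun a => v.map_add_le (hc a) (hc' a), fun z hz => ?_⟩
    have := v.map_add_le (hcz z hz) (hcz' z hz)
    convert this using 2
    simp only [map_add, Pi.add_apply, mul_add, Finset.sum_add_distrib]
    ring

theorem exists_recentered_lift {m : ℕ} (T : MvPolynomial (Fin m) K)
    (hT : ∀ c, v (T.coeff c) ≤ 1) (y : Fin m → K) (hy : ∀ i, v (y i) ≤ 1) :
    ∃ P : MvPolynomial (Fin m) v.integer, ∀ x : Fin m → K,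
      MvPolynomial.aeval (fun i => x i - y i) P = MvPolynomial.eval x T := by
  obtain ⟨T₀, rfl⟩ : ∃ T₀, MvPolynomial.map (algebraMap v.integer K) T₀ = T := by
    rw [← Set.mem_range, MvPolynomial.mem_range_map_iff_coeffs_subset]
    intro c hc
    obtain ⟨u, -, rfl⟩ := MvPolynomial.mem_coeffs_iff.1 hc
    exact ⟨⟨_, hT u⟩, rfl⟩
  refine ⟨MvPolynomial.bind₁ (fun i => .X i + .C (⟨y i, hy i⟩ : v.integer)) T₀, fun x => ?_⟩
  rw [MvPolynomial.aeval_bind₁, MvPolynomial.eval_map, ← MvPolynomial.aeval_def]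
  congr 1
  congr 1
  ext i
  simp [v.algebraMap_integer_apply]

theorem valuation_aeval_le_one {m : ℕ} (P : MvPolynomial (Fin m) v.integer) (z : Fin m → K)
    (hz : ∀ i, v (z i) ≤ 1) : v (MvPolynomial.aeval z P) ≤ 1 := by
  have : MvPolynomial.aeval z P
      = ((MvPolynomial.eval (fun i => (⟨z i, hz i⟩ : v.integer)) P : v.integer) : K) := by
    rw [← MvPolynomial.coe_aeval_eq_eval]
    exact MvPolynomial.aeval_algebraMap_apply K (fun i => (⟨z i, hz i⟩ : v.integer)) P
  rw [this]
  exact (MvPolynomial.eval _ P).2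

/-- All monomials in functions with `T_(R+1)`-approximation are approximated on a polydisc of
radius `ρ` by polynomials of degree at most `R` in `x - y`. -/
theorem TrApprox.exists_monomial_expansion {m n R : ℕ} {U : Set (Fin m → K)}
    (hU : ∀ x ∈ U, ∀ i, v (x i) ≤ 1) {ψ : (Fin m → K) → (Fin n → K)}
    (hψO : ∀ x ∈ U, ∀ i, v (ψ x i) ≤ 1) (hψ : ∀ i, TrApprox v U (fun x => ψ x i) (R + 1))
    {y : Fin m → K} (hy : y ∈ U) {ρ : Γ} (hρ : ρ ≤ 1) (k : Fin n → ℕ) :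
    ∃ c : DeltaIdx m R → K, (∀ a, v (c a) ≤ 1) ∧ ∀ x ∈ U, (∀ i, v (x i - y i) ≤ ρ) →
      v (∏ q, ψ x q ^ k q - ∑ a, (∏ i, (x i - y i) ^ (a.1 i : ℕ)) * c a) ≤ ρ ^ (R + 1) := by
  choose T _ hTint hTapprox using fun q => hψ q y hy
  choose P hP using fun q => exists_recentered_lift v (T q) (hTint q) y (hU y hy)
  obtain ⟨c, hc, hcz⟩ := exists_truncated_expansion v (∏ q, P q ^ k q) hρ R
  refine ⟨c, hc, fun x hx hxy => ?_⟩
  have h2 := hcz (fun i => x i - y i) hxy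
  have h1 : v (∏ q, ψ x q ^ k q
      - ∏ q, MvPolynomial.aeval (fun i => x i - y i) (P q) ^ k q) ≤ ρ ^ (R + 1) := by
    refine v.map_prod_pow_sub_prod_pow_le _ (hψO x hx)
      (fun q => valuation_aeval_le_one v _ _ fun i => (hxy i).trans hρ) (fun q => ?_) k
    rw [hP]
    exact (hTapprox q x hx).trans (pow_le_pow_left' (Finset.sup_le fun i _ => hxy i) _)
  simp only [map_prod, map_pow] at h2
  have := v.map_add_le h1 h2
  rwa [sub_add_sub_cancel] at this

end Valuation

theorem exists_polynomial_of_mem_ktPoly {K : Type*} [Field K] {kt : Subfield K} {t : K} {s : ℕ}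
    {x : K} (hx : x ∈ ktPoly kt t s) :
    ∃ p : Polynomial kt, p.natDegree ≤ s ∧ Polynomial.aeval t p = x := by
  obtain ⟨a, ha, rfl⟩ := hx
  refine ⟨∑ i : Fin s, .C ⟨a i, ha i⟩ * .X ^ (i : ℕ), ?_, ?_⟩
  · exact Polynomial.natDegree_sum_le_of_forall_le _ _ fun i _ =>
      (Polynomial.natDegree_C_mul_X_pow_le _ _).trans i.2.le
  · simp only [map_sum, map_mul, map_pow, Polynomial.aeval_X, Polynomial.aeval_C]
    rfl

theorem Polynomial.natDegree_det_le_sum {R ι : Type*} [CommRing R] [Fintype ι] [DecidableEq ι]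
    (M : Matrix ι ι (Polynomial R)) (g : ι → ℕ) (hM : ∀ i l, (M i l).natDegree ≤ g l) :
    M.det.natDegree ≤ ∑ l, g l := by
  rw [Matrix.det_apply]
  refine Polynomial.natDegree_sum_le_of_forall_le _ _ fun σ _ => ?_
  refine (Polynomial.natDegree_smul_le _ _).trans ((Polynomial.natDegree_prod_le _ _).trans ?_)
  exact Finset.sum_le_sum fun i _ => hM _ _

theorem sum_deltaIdx_degree (m N : ℕ) :
    ∑ a : DeltaIdx m N, ∑ i, (a.1 i : ℕ) = ∑ k ∈ Finset.range (N + 1), k * Lnum m k := by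
  classical
  rw [← Finset.sum_fiberwise_of_maps_to (s := Finset.univ) (t := Finset.range (N + 1))
    (g := fun a : DeltaIdx m N => ∑ i, (a.1 i : ℕ))
    (fun a _ => Finset.mem_range.2 (Nat.lt_succ_of_le a.2))]
  refine Finset.sum_congr rfl fun k hk => ?_
  rw [Finset.sum_congr rfl (fun a ha => (Finset.mem_filter.1 ha).2), Finset.sum_const,
    smul_eq_mul, mul_comm]
  congr 1
  have hkN : k ≤ N := Nat.lt_succ_iff.1 (Finset.mem_range.1 hk)
  rw [Lnum, ← Fintype.card_subtype]
  have hle : ∀ {M : ℕ} (a : Fin m → Fin M) i, (a i : ℕ) ≤ ∑ i, (a i : ℕ) := fun a i =>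
    Finset.single_le_sum (f := fun i => (a i : ℕ)) (fun _ _ => Nat.zero_le _) (Finset.mem_univ i)
  exact Fintype.card_congr
    { toFun := fun a => ⟨fun i => ⟨a.1.1 i, Nat.lt_succ_of_le ((hle _ i).trans a.2.le)⟩, a.2⟩
      invFun := fun a => ⟨⟨fun i => ⟨a.1 i, (a.1 i).2.trans_le (by omega)⟩,
        (show ∑ i, (a.1 i : ℕ) ≤ N from a.2.le.trans hkN)⟩, a.2⟩
      left_inv := fun _ => rfl
      right_inv := fun _ => rfl }

theorem Dnum_pred_rfun_le {m μ : ℕ} (h : rfun m μ ≠ 0) : Dnum m (rfun m μ - 1) ≤ μ :=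
  not_lt.1 (Nat.notMem_of_lt_sInf (s := {x | μ < Dnum m x}) (Nat.sub_one_lt h))

/-- Among the columns of weight `|a|`, for `a` of degree at most `R`, and further columns of
weight `R + 1`, any `μ` distinct ones have at least the stated total weight. -/
theorem le_sum_weight_of_injective {m R : ℕ} {ι κ : Type*} [Fintype ι] [Fintype κ]
    (hι : Dnum m R ≤ Fintype.card ι) (f : ι → DeltaIdx m R ⊕ κ) (hf : Function.Injective f) :
    (∑ k ∈ Finset.range (R + 1), k * Lnum m k) + (R + 1) * (Fintype.card ι - Dnum m R) ≤
      ∑ l, Sum.elim (fun a : DeltaIdx m R => ∑ i, (a.1 i : ℕ)) (fun _ => R + 1) (f l) := by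
  classical
  set w : DeltaIdx m R ⊕ κ → ℕ :=
    Sum.elim (fun a : DeltaIdx m R => ∑ i, (a.1 i : ℕ)) (fun _ => R + 1) with hw
  have hwle : ∀ a, w a ≤ R + 1 := by
    rintro (a | a)
    · exact a.2.trans (Nat.le_succ R)
    · exact le_rfl
  have h1 : ∑ l, (R + 1 - w (f l)) ≤ ∑ a, (R + 1 - w a) := by
    rw [← Finset.sum_image (f := fun a => R + 1 - w a) hf.injOn]
    exact Finset.sum_le_sum_of_subset (Finset.subset_univ _)
  have h2 : ∑ a, (R + 1 - w a) = ∑ a : DeltaIdx m R, (R + 1 - ∑ i, (a.1 i : ℕ)) := by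
    simp [Fintype.sum_sum_type, hw]
  have h3 : ∑ a : DeltaIdx m R, (R + 1 - ∑ i, (a.1 i : ℕ))
      + ∑ a : DeltaIdx m R, ∑ i, (a.1 i : ℕ) = (R + 1) * Dnum m R := by
    rw [← Finset.sum_add_distrib, Finset.sum_congr rfl fun a _ =>
      Nat.sub_add_cancel (a.2.trans (Nat.le_succ R))]
    simp [Dnum, mul_comm]
  have h4 : ∑ l, (R + 1 - w (f l)) + ∑ l, w (f l) = (R + 1) * Fintype.card ι := by
    rw [← Finset.sum_add_distrib, Finset.sum_congr rfl fun l _ => Nat.sub_add_cancel (hwle (f l))]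
    simp [mul_comm]
  rw [sum_deltaIdx_degree] at h3
  have h5 := Nat.mul_le_mul_left (R + 1) hι
  rw [Nat.mul_sub]
  omega

/-- The vanishing of the determinant in the proof of Lemma 4.2: with `μ = D_n(d)`,
`r` the integer with `D_m(r−1) ≤ μ < D_m(r)`, `V = Σ_{k=0}^d k·L_n(k)`,
`e = Σ_{k=1}^{r−1} k·L_m(k) + r·(μ − D_m(r−1))` and `α > sV/e`, if
`ψ : U ⊆ O_K^m → O_K^n` satisfies `T_r`-approximation, `B` is a product of `m` closed
balls of radius `|t|^α` inside `O_K^m` and `x_1, …, x_μ ∈ B ∩ U` have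
`ψ(x_i) ∈ (k̃[t]_s)^n`, then `det((ψ(x_i)^j)_{1≤i≤μ, j∈Δ_n(d)}) = 0`. -/
theorem determinant_vanishes {K Γ : Type*} [Field K] [LinearOrderedCommGroupWithZero Γ]
    (v : Valuation K Γ) [CharZero K]
    (hres : ∀ q : ℕ, 0 < q → v (q : K) = 1) [HenselianLocalRing v.integer]
    (t : K) (ht0 : v t ≠ 0) (ht1 : v t < 1)
    (kt : Subfield K) (hkt : IsLift v kt)
    (d n m : ℕ) (hd : 1 ≤ d) (hm : 1 ≤ m) (hmn : m < n)
    (s α : ℕ) (hs : 0 < s) (hα : s * Vfun n d < α * efun n m d)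
    (U : Set (Fin m → K)) (hU : ∀ x ∈ U, ∀ i, v (x i) ≤ 1)
    (ψ : (Fin m → K) → (Fin n → K))
    (hψO : ∀ x ∈ U, ∀ i, v (ψ x i) ≤ 1)
    (hψ : ∀ i, TrApprox v U (fun x => ψ x i) (rfun m (Dnum n d)))
    (b : Fin m → K) (hb : ∀ i, v (b i) ≤ 1)
    (μ : ℕ) (hμ : μ = Dnum n d)
    (ι : Fin μ → DeltaIdx n d) (hι : Function.Bijective ι)
    (x : Fin μ → (Fin m → K)) (hxU : ∀ i, x i ∈ U)
    (hxB : ∀ i q, v (x i q - b q) ≤ v t ^ α)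
    (hP : ∀ i l, ψ (x i) l ∈ ktPoly kt t s) :
    Matrix.det (Matrix.of fun i l : Fin μ =>
      ∏ q, ψ (x i) q ^ (((ι l).1 q : ℕ))) = 0 := by
  set r := rfun m (Dnum n d) with hr
  have hpos : 0 < μ := by
    rw [hμ]
    exact Fintype.card_pos_iff.2 ⟨⟨fun _ => 0, by simp⟩⟩
  set y := x ⟨0, hpos⟩
  have hyU : y ∈ U := hxU _
  have hr0 : r ≠ 0 := by
    obtain ⟨T, hT, -⟩ := hψ ⟨0, by omega⟩ y hyU
    omega
  obtain ⟨R, hR⟩ := Nat.exists_eq_succ_of_ne_zero hr0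
  have hD : Dnum m R ≤ μ := by
    have := Dnum_pred_rfun_le hr0
    rwa [← hr, hR, Nat.succ_sub_one, ← hμ] at this
  have he : efun n m d
      = (∑ k ∈ Finset.range (R + 1), k * Lnum m k) + (R + 1) * (μ - Dnum m R) := by
    rw [efun, ← hr, hR, Nat.succ_sub_one, ← hμ, Finset.sum_range_succ']
    simp only [zero_mul, add_zero]
    rw [Finset.sum_bij' (fun k _ => k - 1) (fun k _ => k + 1)] <;> simp <;> intros <;> grind
  have hρ : v t ^ α ≤ 1 := pow_le_one' ht1.le _
  have hxy : ∀ i q, v (x i q - y q) ≤ v t ^ α := fun i q => by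
    rw [← sub_sub_sub_cancel_right _ _ (b q)]
    exact v.map_sub_le (hxB _ _) (hxB _ _)
  rw [hR] at hψ
  choose c hc hcx using fun l =>
    TrApprox.exists_monomial_expansion v hU hψO hψ hyU hρ (fun q => ((ι l).1 q : ℕ))
  set M : Matrix (Fin μ) (Fin μ) K :=
    Matrix.of fun i l : Fin μ => ∏ q, ψ (x i) q ^ (((ι l).1 q : ℕ)) with hM
  have hupper : v M.det ≤ v t ^ (α * efun n m d) := by
    let N : Matrix (Fin μ) (DeltaIdx m R) K := .of fun i a => ∏ q, (x i q - y q) ^ (a.1 q : ℕ)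
    let C : Matrix (DeltaIdx m R) (Fin μ) K := .of fun a l => c l a
    have hfac : M = (Matrix.fromCols N (M - N * C) : Matrix (Fin μ) (DeltaIdx m R ⊕ Fin μ) K) *
        (Matrix.fromRows C 1 : Matrix (DeltaIdx m R ⊕ Fin μ) (Fin μ) K) := by
      rw [Matrix.fromCols_mul_fromRows, mul_one, add_sub_cancel]
    rw [hfac, pow_mul]
    refine v.map_det_mul_le _ _ hρ
      (Sum.elim (fun a : DeltaIdx m R => ∑ i, (a.1 i : ℕ)) (fun _ => R + 1)) ?_ ?_ _ ?_
    · rintro i (a | l)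
      · simp only [Matrix.fromCols_apply_inl, Sum.elim_inl, N, Matrix.of_apply, map_prod, map_pow]
        rw [← Finset.prod_pow_eq_pow_sum]
        exact Finset.prod_le_prod' fun q _ => pow_le_pow_left' (hxy i q) _
      · simpa [Matrix.mul_apply, N, C, hM] using hcx l (x i) (hxU i) (hxy i)
    · rintro (a | l') l
      · exact hc l a
      · rw [Matrix.fromRows_apply_inr, Matrix.one_apply]
        split_ifs <;> simp
    · intro f hf
      have := le_sum_weight_of_injective (by simpa using hD) f hf
      rwa [Fintype.card_fin, ← he] at this
  choose p hpdeg hpeval using fun i q => exists_polynomial_of_mem_ktPoly (hP i q)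
  let Q : Matrix (Fin μ) (Fin μ) (Polynomial kt) := .of fun i l => ∏ q, p i q ^ ((ι l).1 q : ℕ)
  have hQdet : Polynomial.aeval t Q.det = M.det := by
    rw [AlgHom.map_det]
    congr 1
    ext i l
    simp [Q, hM, hpeval]
  have hQdeg : Q.det.natDegree ≤ s * Vfun n d := by
    refine (Polynomial.natDegree_det_le_sum Q (fun l => s * ∑ q, ((ι l).1 q : ℕ)) ?_).trans ?_
    · intro i l
      refine (Polynomial.natDegree_prod_le Finset.univ fun q => p i q ^ ((ι l).1 q : ℕ)).trans ?_
      rw [Finset.mul_sum]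
      refine Finset.sum_le_sum fun q _ => Polynomial.natDegree_pow_le.trans ?_
      rw [mul_comm]
      exact Nat.mul_le_mul_right _ (hpdeg i q)
    · rw [← Finset.mul_sum, hι.sum_comp (fun a : DeltaIdx n d => ∑ q, (a.1 q : ℕ)),
        sum_deltaIdx_degree, Vfun]
  by_contra hne
  have hQ0 : Q.det ≠ 0 := fun h => hne (by rw [← hQdet, h, map_zero])
  have hlower := v.pow_le_map_eval_of_mem_subfield hkt.1 ht1 _ Q.det hQ0 hQdeg
  rw [hQdet] at hlower
  exact absurd (hlower.trans hupper)
    (not_le.2 (pow_lt_pow_right_of_lt_one₀ (zero_lt_iff.2 ht0) ht1 hα))
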